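/- Consider a network: a finite directed acyclic multigraph (V, E, tail, head) (acyclicity witnessed by an injection ord : E → ℕ with ord(d) < ord(e) whenever head(d) = tail(e)), distinct source nodes σ_1, …, σ_s (s ≥ 1) with no incoming edges, and a sink node ρ ∉ {σ_1, …, σ_s} with no outgoing edges. Let F be a finite field with q elements, let ℓ, n ≥ 1 and r ∈ ℕ, and let 𝒦_1, …, 𝒦_s be finite nonempty sets. Let (M, K) = ((M_1, …, M_s), (K_1, …, K_s)) be uniformly distributed on (F^ℓ)^s × Π_i 𝒦_i. Let (g_e)_{e∈E}, g_e : (F^ℓ)^s × Π_i 𝒦_i → F^n, be a family of functions such that: if tail(e) = σ_i then g_e(m, k) depends only on (m_i, k_i); otherwise g_e(m, k) = θ_e((g_d(m, k))_{d ∈ In(tail(e))}) for some function θ_e. Assume (computability) there exists φ with φ((g_e(m, k))_{e ∈ In(ρ)}) = Σ_{i=1}^s m_i ∈ F^ℓ for all (m, k), and (target-function security) for every W ⊆ E with |W| ≤ r, the random variables (g_e(M, K))_{e∈W} and Σ_{i=1}^s M_i are independent. Then for every valid pair (C, W) — meaning I_C ≠ ∅, W ⊆ C, |W| ≤ r, and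 either I_C \ D_W ≠ ∅ or D_W = I_C = S — one has ℓ ≤ n · (|C| − |W|). -/

import Mathlib

noncomputable section

/-- Every type is endowed with the `⊤` σ-algebra (every set measurable), the usual choice
for finite sample spaces. -/
local instance (priority := high) topMeasurableSpace (α : Type _) : MeasurableSpace α := ⊤

open ProbabilityTheory

/-- A (directed) path starting at the node `u` and ending at the edge `e`. -/
def IsPathToEdge {V E : Type} (tail head : E → V) (u : V) (p : List E) (e : E) : Prop :=
  (∃ d, p.head? = some d ∧ tail d = u) ∧
    List.Chain' (fun d e' => head d = tail e') p ∧ p.getLast? = some e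

/-- A (directed) path from the node `u` to the node `v`. -/
def IsPathToNode {V E : Type} (tail head : E → V) (u : V) (p : List E) (v : V) : Prop :=
  (∃ d, p.head? = some d ∧ tail d = u) ∧
    List.Chain' (fun d e' => head d = tail e') p ∧
    (∃ d, p.getLast? = some d ∧ head d = v)

/-- `D_W` (as a set of source indices): sources from which some edge of `W` can be reached. -/
def Didx {V E : Type} {s : ℕ} (tail head : E → V) (σ : Fin s → V) (W : Set E) :
    Set (Fin s) :=
  {i | ∃ e ∈ W, ∃ p : List E, IsPathToEdge tail head (σ i) p e}

/-- `I_C` (as a set of source indices): sources `σ_i` such that every path from `σ_i` to the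
sink `ρ` contains an edge of `C`. -/
def Iidx {V E : Type} {s : ℕ} (tail head : E → V) (σ : Fin s → V) (ρ : V) (C : Set E) :
    Set (Fin s) :=
  {i | ∀ p : List E, IsPathToNode tail head (σ i) p ρ → ∃ e ∈ p, e ∈ C}

/-- Source `j` emits the same message and the same key under the outcomes `x` and `y`. -/
def AgreeAt {s : ℕ} {A : Type} {𝒦 : Fin s → Type}
    (x y : (Fin s → A) × ((i : Fin s) → 𝒦 i)) (j : Fin s) : Prop :=
  x.1 j = y.1 j ∧ x.2 j = y.2 j

section Network

variable {V E A B : Type} {tail head : E → V} {ord : E → ℕ} {s : ℕ} {σ : Fin s → V}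
  {𝒦 : Fin s → Type} {g : E → (Fin s → A) × ((i : Fin s) → 𝒦 i) → B}

/-- If two outcomes agree at every source feeding an edge of `P`, and every predecessor of an
edge of `P` lies in `P` or carries equal messages, then the messages agree on `P`. -/
theorem message_eq_of_hereditary
    (hDAG : ∀ d e : E, head d = tail e → ord d < ord e)
    (hsrc : ∀ (e : E) (i : Fin s), tail e = σ i →
      ∃ θ : A × 𝒦 i → B, ∀ m k, g e (m, k) = θ (m i, k i))
    (hrelay : ∀ e : E, tail e ∉ Set.range σ →
      ∃ θ : ({d : E // head d = tail e} → B) → B, ∀ x, g e x = θ (fun d => g d.1 x))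
    {x y : (Fin s → A) × ((i : Fin s) → 𝒦 i)} {P : E → Prop}
    (hP_src : ∀ e i, P e → tail e = σ i → AgreeAt x y i)
    (hP_pred : ∀ d e, P e → head d = tail e → P d ∨ g d x = g d y)
    (e : E) (he : P e) : g e x = g e y := by
  induction h : ord e using Nat.strong_induction_on generalizing e with
  | _ N ih =>
    subst h
    by_cases hr : tail e ∈ Set.range σ
    · obtain ⟨i, hi⟩ := hr
      obtain ⟨θ, hθ⟩ := hsrc e i hi.symm
      obtain ⟨h₁, h₂⟩ := hP_src e i he hi.symm
      have hx := hθ x.1 x.2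
      rw [h₁, h₂] at hx
      exact hx.trans (hθ y.1 y.2).symm
    · obtain ⟨θ, hθ⟩ := hrelay e hr
      rw [hθ, hθ]
      congr 1
      funext ⟨d, hd⟩
      rcases hP_pred d e he hd with h | h
      · exact ih _ (hDAG d e hd) d h rfl
      · exact h

/-- The messages on a cut set `C`, together with the sources not separated by `C` from `ρ`,
determine the messages entering `ρ`. -/
theorem message_into_sink_eq_of_cut {ρ : V}
    (hDAG : ∀ d e : E, head d = tail e → ord d < ord e)
    (hsrc : ∀ (e : E) (i : Fin s), tail e = σ i →
      ∃ θ : A × 𝒦 i → B, ∀ m k, g e (m, k) = θ (m i, k i))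
    (hrelay : ∀ e : E, tail e ∉ Set.range σ →
      ∃ θ : ({d : E // head d = tail e} → B) → B, ∀ x, g e x = θ (fun d => g d.1 x))
    {x y : (Fin s → A) × ((i : Fin s) → 𝒦 i)} {C : Set E}
    (hagree : ∀ j ∉ Iidx tail head σ ρ C, AgreeAt x y j)
    (hC : ∀ e ∈ C, g e x = g e y) (e : E) (he : head e = ρ) : g e x = g e y := by
  by_cases heC : e ∈ C
  · exact hC e heC
  refine message_eq_of_hereditary hDAG hsrc hrelay
    (P := fun e => ∃ p : List E, p.head? = some e ∧ IsPathToNode tail head (tail e) p ρ ∧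
      ∀ d ∈ p, d ∉ C) ?_ ?_ e
    ⟨[e], rfl, ⟨⟨e, rfl, rfl⟩, List.isChain_singleton e, e, rfl, he⟩, by simpa using heC⟩
  · rintro e i ⟨p, -, hp, hpC⟩ hi
    refine hagree i fun hI => ?_
    obtain ⟨d, hd, hdC⟩ := hI p (hi ▸ hp)
    exact hpC d hd hdC
  · rintro d e ⟨p, hpe, ⟨-, hchain, a, ha, haρ⟩, hpC⟩ hd
    by_cases hdC : d ∈ C
    · exact Or.inr (hC d hdC)
    refine Or.inl ⟨d :: p, rfl, ⟨⟨d, rfl, rfl⟩, ?_, a, ?_, haρ⟩, ?_⟩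
    · refine List.isChain_cons.2 ⟨fun b hb => ?_, hchain⟩
      obtain rfl : e = b := by simpa [hpe] using hb
      exact hd
    · simp [List.getLast?_cons, ha]
    · rintro b hb
      rcases List.mem_cons.1 hb with rfl | hb
      · exact hdC
      · exact hpC b hb

/-- The messages on `W` depend only on the sources in `D_W`. -/
theorem message_eq_of_agree_on_Didx
    (hDAG : ∀ d e : E, head d = tail e → ord d < ord e)
    (hsrc : ∀ (e : E) (i : Fin s), tail e = σ i →
      ∃ θ : A × 𝒦 i → B, ∀ m k, g e (m, k) = θ (m i, k i))
    (hrelay : ∀ e : E, tail e ∉ Set.range σ →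
      ∃ θ : ({d : E // head d = tail e} → B) → B, ∀ x, g e x = θ (fun d => g d.1 x))
    {x y : (Fin s → A) × ((i : Fin s) → 𝒦 i)} {W : Set E}
    (hagree : ∀ j ∈ Didx tail head σ W, AgreeAt x y j) (e : E) (he : e ∈ W) :
    g e x = g e y := by
  refine message_eq_of_hereditary hDAG hsrc hrelay
    (P := fun e => ∀ i (p : List E), IsPathToEdge tail head (σ i) p e → AgreeAt x y i)
    ?_ ?_ e fun i p hp => hagree i ⟨e, he, p, hp⟩
  · exact fun e i h hi => h i [e] ⟨⟨e, rfl, hi⟩, List.isChain_singleton e, rfl⟩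
  · rintro d e h hd
    refine Or.inl fun i p ⟨⟨a, ha, hai⟩, hchain, hlast⟩ =>
      h i (p ++ [e]) ⟨⟨a, by simp [ha], hai⟩, ?_, by simp⟩
    refine List.isChain_append.2 ⟨hchain, List.isChain_singleton e, fun b hb c hc => ?_⟩
    obtain rfl : d = b := by simpa [hlast] using hb
    obtain rfl : e = c := by simpa using hc
    exact hd

end Network

/-- Under the uniform distribution, independent variables jointly attain any pair of values
that they attain separately. -/
theorem exists_eq_and_eq_of_indepFun_uniform {Ω α β : Type} [Fintype Ω] [Nonempty Ω]
    {X : Ω → α} {Y : Ω → β} (h : IndepFun X Y (PMF.uniformOfFintype Ω).toMeasure)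
    (x y : Ω) : ∃ ω, X ω = X x ∧ Y ω = Y y := by
  have hpos : ∀ S : Set Ω, (PMF.uniformOfFintype Ω).toMeasure S = 0 ↔ S = ∅ := fun S => by
    rw [PMF.toMeasure_apply_eq_zero_iff _ MeasurableSpace.measurableSet_top,
      PMF.support_uniformOfFintype, Set.top_eq_univ, Set.univ_disjoint]
  by_contra! hne
  have hmul := h.measure_inter_preimage_eq_mul {X x} {Y y}
    MeasurableSpace.measurableSet_top MeasurableSpace.measurableSet_top
  have hempty : X ⁻¹' {X x} ∩ Y ⁻¹' {Y y} = ∅ :=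
    Set.eq_empty_of_forall_notMem fun ω hω => hne ω hω.1 hω.2
  rw [(hpos _).2 hempty, eq_comm, mul_eq_zero, hpos, hpos] at hmul
  rcases hmul with h | h
  · exact h.subset (show x ∈ X ⁻¹' {X x} from rfl)
  · exact h.subset (show y ∈ Y ⁻¹' {Y y} from rfl)

/-- Theorem 1 (per code): every admissible `(ℓ, n)` secure network code for the
target-function-security model `⟨N, f, r⟩`, with `f` the algebraic sum over a finite field
`F`, satisfies `ℓ ≤ n (|C| − |W|)` for every valid pair `(C, W)`. Here `(M, K)` is uniform
on `(F^ℓ)^s × Π_i 𝒦_i`, the `g_e` are the global encoding functions induced by local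
encoding functions, `φ` computes `Σ_i m_i` from the in-edges of `ρ` (computability), and for
each wiretap set `W` of size at most `r` the messages on `W` are independent of `Σ_i M_i`
(target-function security). -/
theorem rate_le_of_valid_pair
    {V E : Type} [Fintype V] [Fintype E] (tail head : E → V)
    (ord : E → ℕ) (hord : Function.Injective ord)
    (hDAG : ∀ d e : E, head d = tail e → ord d < ord e)
    {s : ℕ} (hs : 1 ≤ s) (σ : Fin s → V) (hσ : Function.Injective σ)
    (ρ : V) (hρ : ρ ∉ Set.range σ)
    (hNoIn : ∀ (e : E) (i : Fin s), head e ≠ σ i)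
    (hNoOut : ∀ e : E, tail e ≠ ρ)
    {F : Type} [Field F] [Fintype F] [DecidableEq F] (q : ℕ) (hq : Fintype.card F = q)
    (l n : ℕ) (hl : 1 ≤ l) (hn : 1 ≤ n) (r : ℕ)
    (𝒦 : Fin s → Type) [∀ i, Fintype (𝒦 i)] [∀ i, Nonempty (𝒦 i)]
    (g : E → (Fin s → Fin l → F) × ((i : Fin s) → 𝒦 i) → (Fin n → F))
    (hsrc : ∀ (e : E) (i : Fin s), tail e = σ i →
      ∃ θ : (Fin l → F) × 𝒦 i → (Fin n → F), ∀ m k, g e (m, k) = θ (m i, k i))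
    (hrelay : ∀ e : E, tail e ∉ Set.range σ →
      ∃ θ : ({d : E // head d = tail e} → (Fin n → F)) → (Fin n → F),
        ∀ x, g e x = θ (fun d => g d.1 x))
    (φ : ({d : E // head d = ρ} → (Fin n → F)) → (Fin l → F))
    (hφ : ∀ (m : Fin s → Fin l → F) (k : (i : Fin s) → 𝒦 i),
      φ (fun d => g d.1 (m, k)) = ∑ i, m i)
    (hsec : ∀ W : Finset E, W.card ≤ r →
      IndepFun
        (fun ω : (Fin s → Fin l → F) × ((i : Fin s) → 𝒦 i) =>
          (fun e : {e : E // e ∈ W} => g e.1 ω))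
        (fun ω : (Fin s → Fin l → F) × ((i : Fin s) → 𝒦 i) => ∑ i, ω.1 i)
        (PMF.uniformOfFintype ((Fin s → Fin l → F) × ((i : Fin s) → 𝒦 i))).toMeasure)
    (C W : Finset E)
    (hIC : (Iidx tail head σ ρ ↑C).Nonempty)
    (hWC : W ⊆ C) (hWr : W.card ≤ r)
    (hvalid : (Iidx tail head σ ρ ↑C \ Didx tail head σ ↑W).Nonempty ∨
      (Didx tail head σ ↑W = Set.univ ∧ Iidx tail head σ ρ ↑C = Set.univ)) :
    l ≤ n * (C.card - W.card) := by
  classical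
  -- It suffices to find outcomes realising every sum, indistinguishable on `W` and outside `I_C`.
  suffices H : ∃ ω : (Fin l → F) → (Fin s → Fin l → F) × ((i : Fin s) → 𝒦 i),
      (∀ v, ∑ i, (ω v).1 i = v) ∧ (∀ u v, ∀ e ∈ W, g e (ω u) = g e (ω v)) ∧
      ∀ u v, ∀ j ∉ Iidx tail head σ ρ (C : Set E), AgreeAt (ω u) (ω v) j by
    obtain ⟨ω, hsum, hW, hagree⟩ := H
    have hinj : Function.Injective
        (fun (v : Fin l → F) (e : {e // e ∈ C \ W}) => g e.1 (ω v)) := by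
      intro u v huv
      have hC : ∀ e ∈ (C : Set E), g e (ω u) = g e (ω v) := fun e he => by
        by_cases heW : e ∈ W
        · exact hW u v e heW
        · exact congrFun huv ⟨e, Finset.mem_sdiff.2 ⟨he, heW⟩⟩
      rw [← hsum u, ← hsum v, ← hφ (ω u).1 (ω u).2, ← hφ (ω v).1 (ω v).2]
      congr 1
      funext ⟨d, hd⟩
      exact message_into_sink_eq_of_cut hDAG hsrc hrelay (hagree u v) hC d hd
    have hcard := Fintype.card_le_of_injective _ hinj
    simp only [Fintype.card_fun, Fintype.card_fin, Fintype.card_coe, ← pow_mul,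
      Finset.card_sdiff_of_subset hWC] at hcard
    exact (Nat.pow_le_pow_iff_right Fintype.one_lt_card).1 hcard
  have hsingle : ∀ (i : Fin s) (v : Fin l → F),
      ∑ j, (Pi.single i v : Fin s → Fin l → F) j = v := fun i v => by
    simp
  obtain ⟨k⟩ : Nonempty ((i : Fin s) → 𝒦 i) := inferInstance
  rcases hvalid with ⟨i, hiI, hiD⟩ | ⟨-, hI⟩
  · have hagree : ∀ (u v : Fin l → F) (j : Fin s), j ≠ i →
        AgreeAt ((Pi.single i u : Fin s → Fin l → F), k) (Pi.single i v, k) j :=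
      fun u v j hj => ⟨by simp [hj], rfl⟩
    refine ⟨fun v => (Pi.single i v, k), hsingle i, fun u v e he => ?_,
      fun u v j hj => hagree u v j fun hji => hj (hji ▸ hiI)⟩
    exact message_eq_of_agree_on_Didx hDAG hsrc hrelay
      (fun j hj => hagree u v j fun hji => hiD (hji ▸ hj)) e he
  · obtain ⟨i, -⟩ := hIC
    have hex := fun v : Fin l → F =>
      exists_eq_and_eq_of_indepFun_uniform (hsec W hWr) (0, k) (Pi.single i v, k)
    choose ω hωW hωsum using hex
    exact ⟨ω, fun v => (hωsum v).trans (hsingle i v),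
      fun u v e he => congrFun ((hωW u).trans (hωW v).symm) ⟨e, he⟩,
      fun u v j hj => absurd (hI ▸ Set.mem_univ j) hj⟩

end
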